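/- arXiv:2304.08846 — 2 statements merged into one kernel-verified Lean document; each statement's English description precedes it below -/
import Mathlib

section
/- Let k ≥ 4, s ≥ 1 and t be integers with t ≥ (k−2)s + 3, and let n ≥ s + t. Then λ₁(D(K_s ∨ (K_{n-(k-1)s-2} ∪ ((k−2)s+2)K₁))) ≤ λ₁(D(K_s ∨ (K_{n-s-(t-1)} ∪ (t−1)K₁))), with equality if and only if t = (k−2)s + 3 (i.e., if and only if the two graphs are isomorphic). -/
/-- The disjoint union `G ∪ H` of two simple graphs (on the sum of the vertex types). -/
def graphDisjUnion {α β : Type*} (G : SimpleGraph α) (H : SimpleGraph β) :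
    SimpleGraph (α ⊕ β) :=
  SimpleGraph.fromRel (Sum.LiftRel G.Adj H.Adj)

/-- The join `G ∨ H` of two simple graphs: the disjoint union together with all edges
between the two parts. -/
def graphJoin {α β : Type*} (G : SimpleGraph α) (H : SimpleGraph β) :
    SimpleGraph (α ⊕ β) :=
  SimpleGraph.fromRel (fun u v => Sum.LiftRel G.Adj H.Adj u v ∨ (u.isLeft ∧ v.isRight))

/-- The distance matrix of a graph: the `(u,v)` entry is the graph distance `d_G(u,v)`. -/
noncomputable def distMatrix {V : Type*} [Fintype V] (G : SimpleGraph V) :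
    Matrix V V ℝ :=
  Matrix.of fun u v => (G.dist u v : ℝ)

/-- The distance spectral radius `λ₁(D(G))`: the largest eigenvalue of the distance
matrix of `G` (for a connected graph the distance matrix is symmetric nonnegative, so this
is the largest element of its real spectrum). -/
noncomputable def distSpecRad {V : Type*} [Fintype V] [DecidableEq V]
    (G : SimpleGraph V) : ℝ :=
  sSup (spectrum ℝ (distMatrix G))

/-- `G` has a spanning `k`-tree: a spanning subgraph which is a tree of maximum degree
at most `k`. -/
def HasSpanningKTree {V : Type*} [Fintype V] (G : SimpleGraph V) (k : ℕ) : Prop :=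
  ∃ T : SimpleGraph V, T ≤ G ∧ T.IsTree ∧ ∀ v : V, (T.neighborSet v).ncard ≤ k

/-- The Wiener index `W(G) = ∑_{i<j} d_G(v_i, v_j)`, written as half of the full double
sum of distances. -/
noncomputable def wiener {V : Type*} [Fintype V] (G : SimpleGraph V) : ℝ :=
  (∑ u : V, ∑ v : V, (G.dist u v : ℝ)) / 2

/-- The graph `G* = K₁ ∨ (K_{n-k-1} ∪ kK₁)`. -/
def starGraph (n k : ℕ) : SimpleGraph (Fin 1 ⊕ (Fin (n - k - 1) ⊕ Fin k)) :=
  graphJoin (⊤ : SimpleGraph (Fin 1))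
    (graphDisjUnion (⊤ : SimpleGraph (Fin (n - k - 1))) (⊥ : SimpleGraph (Fin k)))

/-- The graph `G♯ = K_{(n-3)/3} ∨ ((2n+3)/3)K₁`. -/
def sharpGraph (n : ℕ) : SimpleGraph (Fin ((n - 3) / 3) ⊕ Fin ((2 * n + 3) / 3)) :=
  graphJoin (⊤ : SimpleGraph (Fin ((n - 3) / 3))) (⊥ : SimpleGraph (Fin ((2 * n + 3) / 3)))

/-- The graph `G̃ = K_s ∨ (K_{n-(k-1)s-2} ∪ ((k-2)s+2)K₁)`. -/
def tildeGraph (n k s : ℕ) :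
    SimpleGraph (Fin s ⊕ (Fin (n - (k - 1) * s - 2) ⊕ Fin ((k - 2) * s + 2))) :=
  graphJoin (⊤ : SimpleGraph (Fin s))
    (graphDisjUnion (⊤ : SimpleGraph (Fin (n - (k - 1) * s - 2)))
      (⊥ : SimpleGraph (Fin ((k - 2) * s + 2))))

/-- The graph `G' = K_s ∨ (K_{n-s-(t-1)} ∪ (t-1)K₁)`. -/
def primeGraph (n s t : ℕ) :
    SimpleGraph (Fin s ⊕ (Fin (n - s - (t - 1)) ⊕ Fin (t - 1))) :=
  graphJoin (⊤ : SimpleGraph (Fin s))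
    (graphDisjUnion (⊤ : SimpleGraph (Fin (n - s - (t - 1)))) (⊥ : SimpleGraph (Fin (t - 1))))

open Matrix

section SpectralRadius

theorem Matrix.dotProduct_mulVec_eq_sum {V : Type*} [Fintype V] {A : Matrix V V ℝ}
    (x y : V → ℝ) :
    x ⬝ᵥ (A *ᵥ y) = ∑ i, ∑ j, x i * (A i j * y j) := by
  simp only [dotProduct, mulVec, Finset.mul_sum]

variable {V : Type*} [Fintype V] [DecidableEq V] {A B : Matrix V V ℝ}

/-- A real symmetric matrix on a nonempty index type attains the supremum of its spectrum. -/
theorem Matrix.IsHermitian.sSup_spectrum_mem [Nonempty V] (hA : A.IsHermitian) :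
    sSup (spectrum ℝ A) ∈ spectrum ℝ A :=
  Set.Nonempty.csSup_mem ⟨_, hA.eigenvalues_mem_spectrum_real (Classical.arbitrary V)⟩
    A.finite_real_spectrum

theorem Matrix.IsHermitian.posSemidef_sSup_spectrum_sub (hA : A.IsHermitian) :
    (algebraMap ℝ (Matrix V V ℝ) (sSup (spectrum ℝ A)) - A).PosSemidef := by
  rw [posSemidef_iff_isHermitian_and_spectrum_nonneg]
  refine ⟨?_, ?_⟩
  · rw [Algebra.algebraMap_eq_smul_one]
    exact (isHermitian_one.smul (.all _)).sub hA
  · rw [← spectrum.singleton_sub_eq]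
    rintro _ ⟨_, rfl, b, hb, rfl⟩
    exact sub_nonneg.2 (le_csSup A.finite_real_spectrum.bddAbove hb)

theorem Matrix.algebraMap_sub_mulVec (r : ℝ) (x : V → ℝ) :
    (algebraMap ℝ (Matrix V V ℝ) r - A) *ᵥ x = r • x - A *ᵥ x := by
  rw [sub_mulVec, Algebra.algebraMap_eq_smul_one, smul_mulVec, one_mulVec]

theorem Matrix.exists_mulVec_eq_smul_of_mem_spectrum {r : ℝ} (hr : r ∈ spectrum ℝ A) :
    ∃ x : V → ℝ, x ≠ 0 ∧ A *ᵥ x = r • x := by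
  rw [spectrum.mem_iff, isUnit_iff_isUnit_det, isUnit_iff_ne_zero, not_not] at hr
  obtain ⟨x, hx, h⟩ := exists_mulVec_eq_zero_iff.2 hr
  rw [algebraMap_sub_mulVec] at h
  exact ⟨x, hx, (sub_eq_zero.1 h).symm⟩

/-- Strict monotonicity of the largest eigenvalue for nonnegative symmetric matrices, when the
larger matrix has positive off-diagonal entries. -/
theorem Matrix.sSup_spectrum_lt_of_le (hA : A.IsHermitian) (hB : B.IsHermitian)
    (hA0 : ∀ i j, 0 ≤ A i j) (hB0 : ∀ i j, i ≠ j → 0 < B i j) (hAB : ∀ i j, A i j ≤ B i j)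
    {u v : V} (huv : A u v < B u v) :
    sSup (spectrum ℝ A) < sSup (spectrum ℝ B) := by
  have : Nonempty V := ⟨u⟩
  obtain ⟨x, hx, hAx⟩ := exists_mulVec_eq_smul_of_mem_spectrum hA.sSup_spectrum_mem
  have hP := hB.posSemidef_sSup_spectrum_sub
  set a := sSup (spectrum ℝ A)
  set b := sSup (spectrum ℝ B)
  set y : V → ℝ := fun i => |x i| with hy
  have hy0 : ∀ i, 0 ≤ y i := fun i => abs_nonneg _
  have hyy : y ⬝ᵥ y = x ⬝ᵥ x := by simp [dotProduct, hy]
  have hpos : 0 < y ⬝ᵥ y := by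
    rw [hyy]
    exact (Finset.sum_nonneg fun i _ => mul_self_nonneg (x i) : 0 ≤ x ⬝ᵥ x).lt_of_ne fun h => hx (dotProduct_self_eq_zero.1 h.symm)
  have h1 : a * (y ⬝ᵥ y) ≤ y ⬝ᵥ (A *ᵥ y) := by
    have : a * (x ⬝ᵥ x) = x ⬝ᵥ (A *ᵥ x) := by rw [hAx, dotProduct_smul, smul_eq_mul]
    rw [hyy, this, dotProduct_mulVec_eq_sum, dotProduct_mulVec_eq_sum]
    refine Finset.sum_le_sum fun i _ => Finset.sum_le_sum fun j _ => ?_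
    refine (le_abs_self _).trans_eq ?_
    rw [abs_mul, abs_mul, abs_of_nonneg (hA0 i j)]
  have hle : ∀ i j, y i * (A i j * y j) ≤ y i * (B i j * y j) := fun i j =>
    mul_le_mul_of_nonneg_left (mul_le_mul_of_nonneg_right (hAB i j) (hy0 j)) (hy0 i)
  have h2 : y ⬝ᵥ (A *ᵥ y) ≤ y ⬝ᵥ (B *ᵥ y) := by
    rw [dotProduct_mulVec_eq_sum, dotProduct_mulVec_eq_sum]
    exact Finset.sum_le_sum fun i _ => Finset.sum_le_sum fun j _ => hle i j
  have hquad : y ⬝ᵥ ((algebraMap ℝ (Matrix V V ℝ) b - B) *ᵥ y)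
      = b * (y ⬝ᵥ y) - y ⬝ᵥ (B *ᵥ y) := by
    rw [algebraMap_sub_mulVec, dotProduct_sub, dotProduct_smul, smul_eq_mul]
  have h3 : y ⬝ᵥ (B *ᵥ y) ≤ b * (y ⬝ᵥ y) := by
    have := hP.dotProduct_mulVec_nonneg y
    rw [star_trivial, hquad] at this
    linarith
  by_contra! hba
  have h4 : b * (y ⬝ᵥ y) ≤ a * (y ⬝ᵥ y) := mul_le_mul_of_nonneg_right hba hpos.le
  have hBy : B *ᵥ y = b • y := by
    have := (hP.dotProduct_mulVec_zero_iff y).1 (by rw [star_trivial, hquad]; linarith)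
    rw [algebraMap_sub_mulVec] at this
    exact (sub_eq_zero.1 this).symm
  have hypos : ∀ i, 0 < y i := by
    intro i
    refine (hy0 i).lt_of_ne fun hi => hpos.ne' ?_
    have hsum : ∑ j, B i j * y j = 0 := by
      have := congrFun hBy i
      rwa [Pi.smul_apply, ← hi, smul_zero] at this
    have hterm : ∀ j, 0 ≤ B i j * y j := fun j =>
      mul_nonneg ((hA0 i j).trans (hAB i j)) (hy0 j)
    have hyj : y = 0 := by
      funext j
      by_cases hij : i = j
      · rw [← hij, ← hi]; rfl
      · have := (Finset.sum_eq_zero_iff_of_nonneg fun j _ => hterm j).1 hsum j (Finset.mem_univ j)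
        exact (mul_eq_zero.1 this).resolve_left (hB0 i j hij).ne'
    rw [hyj, dotProduct_zero]
  have hlt : y ⬝ᵥ (A *ᵥ y) < y ⬝ᵥ (B *ᵥ y) := by
    rw [dotProduct_mulVec_eq_sum, dotProduct_mulVec_eq_sum]
    refine Finset.sum_lt_sum (fun i _ => Finset.sum_le_sum fun j _ => hle i j)
      ⟨u, Finset.mem_univ u, Finset.sum_lt_sum (fun j _ => hle u j) ⟨v, Finset.mem_univ v, ?_⟩⟩
    exact mul_lt_mul_of_pos_left (mul_lt_mul_of_pos_right huv (hypos v)) (hypos u)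
  linarith

end SpectralRadius

section Distance

theorem isHermitian_distMatrix {V : Type*} [Fintype V] (G : SimpleGraph V) :
    (distMatrix G).IsHermitian := by
  ext u v
  simp [distMatrix, SimpleGraph.dist_comm]

variable {V W : Type*} [Fintype V] [DecidableEq V] [Fintype W] [DecidableEq W]

/-- Adding edges to a connected graph strictly decreases the distance spectral radius. -/
theorem distSpecRad_lt_of_lt {G H : SimpleGraph V} (hG : G.Connected) (hGH : G < H) :
    distSpecRad H < distSpecRad G := by
  obtain ⟨u, v, hH, hnG⟩ : ∃ u v, H.Adj u v ∧ ¬ G.Adj u v := by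
    by_contra! h
    exact hGH.not_ge fun u v => h u v
  refine Matrix.sSup_spectrum_lt_of_le (isHermitian_distMatrix H) (isHermitian_distMatrix G)
    (u := u) (v := v) (fun i j => ?_) (fun i j hij => ?_) (fun i j => ?_) ?_
  · simp [distMatrix]
  · simpa [distMatrix] using hG.pos_dist_of_ne hij
  · simpa [distMatrix] using (hG i j).dist_anti hGH.le
  · have := hG.one_lt_dist_of_ne_of_not_adj hH.ne hnG
    simpa [distMatrix, SimpleGraph.dist_eq_one_iff_adj.2 hH] using this

theorem SimpleGraph.Reachable.dist_map_le {V W : Type*} {G : SimpleGraph V} {H : SimpleGraph W}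
    {u v : V} (h : G.Reachable u v) (f : G →g H) : H.dist (f u) (f v) ≤ G.dist u v := by
  obtain ⟨p, hp⟩ := h.exists_walk_length_eq_dist
  rw [← hp, ← p.length_map f]
  exact SimpleGraph.dist_le _

theorem SimpleGraph.Connected.dist_iso {V W : Type*} {G : SimpleGraph V} {H : SimpleGraph W}
    (hG : G.Connected) (e : G ≃g H) (u v : V) : H.dist (e u) (e v) = G.dist u v := by
  refine le_antisymm ((hG u v).dist_map_le e.toHom) ?_
  simpa using ((e.connected_iff.1 hG) (e u) (e v)).dist_map_le e.symm.toHom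

theorem distSpecRad_eq_of_iso {G : SimpleGraph V} {H : SimpleGraph W} (hG : G.Connected)
    (e : G ≃g H) : distSpecRad G = distSpecRad H := by
  have : distMatrix H = Matrix.reindexAlgEquiv ℝ ℝ e.toEquiv (distMatrix G) := by
    ext u v
    have := hG.dist_iso e (e.symm u) (e.symm v)
    simp only [RelIso.apply_symm_apply] at this
    exact congrArg Nat.cast this
  rw [distSpecRad, distSpecRad, this, AlgEquiv.spectrum_eq]

end Distance

section CompleteSplit

/-- The graph `K_α ∨ (K_β ∪ γK₁)`. -/
def joinCliqueIndep (α β γ : Type*) : SimpleGraph (α ⊕ (β ⊕ γ)) :=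
  graphJoin (⊤ : SimpleGraph α) (graphDisjUnion (⊤ : SimpleGraph β) (⊥ : SimpleGraph γ))

variable {α β γ δ : Type*}

theorem joinCliqueIndep_adj_inl {a : α} {u : α ⊕ (β ⊕ γ)} (h : Sum.inl a ≠ u) :
    (joinCliqueIndep α β γ).Adj (Sum.inl a) u := by
  rcases u with a' | u
  · simp_all [joinCliqueIndep, graphJoin]
  · simp [joinCliqueIndep, graphJoin]

theorem joinCliqueIndep_adj_inr {u v : β ⊕ γ} :
    (joinCliqueIndep α β γ).Adj (Sum.inr u) (Sum.inr v) ↔ u ≠ v ∧ u.isLeft ∧ v.isLeft := by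
  rcases u with b | c <;> rcases v with b' | c' <;>
    simp +contextual [joinCliqueIndep, graphJoin, graphDisjUnion, ne_comm]

theorem joinCliqueIndep_connected [Nonempty α] : (joinCliqueIndep α β γ).Connected := by
  obtain ⟨a⟩ := ‹Nonempty α›
  refine (SimpleGraph.connected_iff_exists_forall_reachable _).2 ⟨Sum.inl a, fun u => ?_⟩
  by_cases h : Sum.inl a = u
  · rw [h]
  · exact (joinCliqueIndep_adj_inl h).reachable

/-- Moving vertices from the clique part to the independent part strictly increases the
distance spectral radius, as long as the clique part stays nonempty. -/
theorem distSpecRad_joinCliqueIndep_lt [Fintype α] [Fintype β] [Fintype γ] [Fintype δ]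
    [DecidableEq α] [DecidableEq β] [DecidableEq γ] [DecidableEq δ]
    [Nonempty α] [hβ : Nonempty β] [hδ : Nonempty δ] :
    distSpecRad (joinCliqueIndep α (β ⊕ δ) γ) < distSpecRad (joinCliqueIndep α β (δ ⊕ γ)) := by
  let e : α ⊕ ((β ⊕ δ) ⊕ γ) ≃ α ⊕ (β ⊕ (δ ⊕ γ)) :=
    Equiv.sumCongr (Equiv.refl α) (Equiv.sumAssoc β δ γ)
  have iso : (joinCliqueIndep α β (δ ⊕ γ)).comap e ≃g joinCliqueIndep α β (δ ⊕ γ) :=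
    SimpleGraph.Iso.comap e _
  have hconn := iso.connected_iff.2 joinCliqueIndep_connected
  rw [← distSpecRad_eq_of_iso hconn iso]
  refine distSpecRad_lt_of_lt hconn (lt_of_le_not_ge ?_ ?_)
  · rintro (a | u) (a' | v) h
    · exact joinCliqueIndep_adj_inl h.ne
    · exact joinCliqueIndep_adj_inl h.ne
    · exact (joinCliqueIndep_adj_inl h.symm.ne).symm
    · have hne : u ≠ v := fun huv => h.ne (congrArg Sum.inr huv)
      have h' := (joinCliqueIndep_adj_inr.1 h).2
      refine joinCliqueIndep_adj_inr.2 ⟨hne, ?_⟩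
      rcases u with (b | d) | c <;> rcases v with (b' | d') | c' <;> simp_all [e]
  · intro hle
    obtain ⟨b⟩ := hβ
    obtain ⟨d⟩ := hδ
    have h : (joinCliqueIndep α (β ⊕ δ) γ).Adj (Sum.inr (Sum.inl (Sum.inl b)))
        (Sum.inr (Sum.inl (Sum.inr d))) := joinCliqueIndep_adj_inr.2 (by simp)
    have h' : (joinCliqueIndep α β (δ ⊕ γ)).Adj (Sum.inr (Sum.inl b))
        (Sum.inr (Sum.inr (Sum.inl d))) := hle h
    simpa using (joinCliqueIndep_adj_inr.1 h').2

/-- The graph `K_α ∨ (K_β ∪ γK₁)` depends only on the types up to equivalence. -/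
def joinCliqueIndepCongr {α' β' γ' : Type*} (f : α ≃ α') (g : β ≃ β') (h : γ ≃ γ') :
    joinCliqueIndep α β γ ≃g joinCliqueIndep α' β' γ' where
  toEquiv := Equiv.sumCongr f (Equiv.sumCongr g h)
  map_rel_iff' := by
    rintro (a | b | c) (a' | b' | c') <;>
      simp [joinCliqueIndep, graphJoin, graphDisjUnion]

theorem distSpecRad_joinCliqueIndep_fin_lt {s c d m : ℕ} (hs : 0 < s) (hc : 0 < c) (hd : 0 < d) :
    distSpecRad (joinCliqueIndep (Fin s) (Fin (c + d)) (Fin m)) <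
      distSpecRad (joinCliqueIndep (Fin s) (Fin c) (Fin (d + m))) := by
  have : NeZero s := ⟨hs.ne'⟩
  have : NeZero c := ⟨hc.ne'⟩
  have : NeZero d := ⟨hd.ne'⟩
  rw [← distSpecRad_eq_of_iso joinCliqueIndep_connected
      (joinCliqueIndepCongr (.refl (Fin s)) finSumFinEquiv (.refl (Fin m))),
    ← distSpecRad_eq_of_iso joinCliqueIndep_connected
      (joinCliqueIndepCongr (.refl (Fin s)) (.refl (Fin c)) finSumFinEquiv)]
  exact distSpecRad_joinCliqueIndep_lt

end CompleteSplit

/-- **Claim 1 (Statement 7).** Let `k ≥ 4`, `s ≥ 1`, `t ≥ (k-2)s + 3`, and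
`n ≥ s + t`. Then `λ₁(D(G̃)) ≤ λ₁(D(G'))` where
`G̃ = K_s ∨ (K_{n-(k-1)s-2} ∪ ((k-2)s+2)K₁)` and
`G' = K_s ∨ (K_{n-s-(t-1)} ∪ (t-1)K₁)`, with equality iff `t = (k-2)s + 3`. -/
theorem distSpecRad_tilde_le_prime (k s t n : ℕ) (hk : 4 ≤ k) (hs : 1 ≤ s)
    (ht : (k - 2) * s + 3 ≤ t) (hn : s + t ≤ n) :
    distSpecRad (tildeGraph n k s) ≤ distSpecRad (primeGraph n s t) ∧
    (distSpecRad (tildeGraph n k s) = distSpecRad (primeGraph n s t) ↔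
      t = (k - 2) * s + 3) := by
  have htilde : distSpecRad (tildeGraph n k s) = distSpecRad (joinCliqueIndep (Fin s)
      (Fin (n - (k - 1) * s - 2)) (Fin ((k - 2) * s + 2))) := rfl
  have hprime : distSpecRad (primeGraph n s t) = distSpecRad (joinCliqueIndep (Fin s)
      (Fin (n - s - (t - 1))) (Fin (t - 1))) := rfl
  rw [htilde, hprime]
  obtain ⟨l, rfl⟩ : ∃ l, k = l + 2 := ⟨k - 2, by omega⟩
  have hmul : (l + 2 - 1) * s = l * s + s := by
    rw [show l + 2 - 1 = l + 1 by omega, add_mul, one_mul]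
  rw [Nat.add_sub_cancel] at ht ⊢
  obtain ⟨d, hd⟩ := Nat.exists_eq_add_of_le ht
  have hm : t - 1 = d + (l * s + 2) := by omega
  have hc : n - (l + 2 - 1) * s - 2 = n - s - (t - 1) + d := by omega
  rw [hc, hm]
  rcases Nat.eq_zero_or_pos d with rfl | hd0
  · rw [Nat.zero_add]
    exact ⟨le_rfl, iff_of_true rfl hd⟩
  · have hlt := distSpecRad_joinCliqueIndep_fin_lt (s := s) (c := n - s - (d + (l * s + 2)))
      (d := d) (m := l * s + 2) hs (by omega) hd0
    exact ⟨hlt.le, iff_of_false hlt.ne (by omega)⟩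
end

section
/- Let n ≥ 12 be an integer with n ≡ 0 (mod 3). Then λ₁(D(K₁ ∨ (K_{n-5} ∪ 4K₁))) < λ₁(D(K_{(n-3)/3} ∨ ((2n+3)/3)K₁)). -/
open scoped Matrix

theorem SimpleGraph.dist_eq_two_of_adj_adj {V : Type*} {G : SimpleGraph V} {u v w : V}
    (hne : u ≠ v) (hn : ¬ G.Adj u v) (h₁ : G.Adj u w) (h₂ : G.Adj w v) : G.dist u v = 2 := by
  have hle : G.dist u v ≤ 2 := G.dist_le (.cons h₁ (.cons h₂ .nil))
  have hr : G.Reachable u v := h₁.reachable.trans h₂.reachable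
  have h0 : G.dist u v ≠ 0 := fun h => hne (hr.dist_eq_zero_iff.1 h)
  have h1 : G.dist u v ≠ 1 := fun h => hn (SimpleGraph.dist_eq_one_iff_adj.1 h)
  omega

section Join

variable {α β : Type*} {G : SimpleGraph α} {H : SimpleGraph β}

theorem graphJoin_adj_inl_inl {a b : α} :
    (graphJoin G H).Adj (.inl a) (.inl b) ↔ G.Adj a b := by
  simp only [graphJoin, SimpleGraph.fromRel_adj]
  simp [G.adj_comm b a]
  exact fun h => h.ne

theorem graphJoin_adj_inr_inr {a b : β} :
    (graphJoin G H).Adj (.inr a) (.inr b) ↔ H.Adj a b := by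
  simp only [graphJoin, SimpleGraph.fromRel_adj]
  simp [H.adj_comm b a]
  exact fun h => h.ne

theorem graphJoin_adj_inl_inr {a : α} {b : β} : (graphJoin G H).Adj (.inl a) (.inr b) := by
  simp [graphJoin, SimpleGraph.fromRel_adj]

theorem graphDisjUnion_adj_inl_inl {a b : α} :
    (graphDisjUnion G H).Adj (.inl a) (.inl b) ↔ G.Adj a b := by
  simp only [graphDisjUnion, SimpleGraph.fromRel_adj]
  simp [G.adj_comm b a]
  exact fun h => h.ne

theorem graphDisjUnion_adj_inr_inr {a b : β} :
    (graphDisjUnion G H).Adj (.inr a) (.inr b) ↔ H.Adj a b := by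
  simp only [graphDisjUnion, SimpleGraph.fromRel_adj]
  simp [H.adj_comm b a]
  exact fun h => h.ne

theorem not_graphDisjUnion_adj_inl_inr {a : α} {b : β} :
    ¬ (graphDisjUnion G H).Adj (.inl a) (.inr b) := by
  simp [graphDisjUnion, SimpleGraph.fromRel_adj]

theorem not_graphDisjUnion_adj_inr_inl {a : α} {b : β} :
    ¬ (graphDisjUnion G H).Adj (.inr b) (.inl a) :=
  fun h => not_graphDisjUnion_adj_inl_inr h.symm

theorem graphJoin_dist_inl_inr (a : α) (b : β) :
    (graphJoin G H).dist (.inl a) (.inr b) = 1 :=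
  SimpleGraph.dist_eq_one_iff_adj.2 graphJoin_adj_inl_inr

theorem graphJoin_dist_inr_inl (a : α) (b : β) :
    (graphJoin G H).dist (.inr b) (.inl a) = 1 :=
  SimpleGraph.dist_eq_one_iff_adj.2 graphJoin_adj_inl_inr.symm

theorem graphJoin_top_dist_inl_inl [DecidableEq α] (a b : α) :
    (graphJoin (⊤ : SimpleGraph α) H).dist (.inl a) (.inl b) = if a = b then 0 else 1 := by
  split_ifs with h
  · simp [h]
  · exact SimpleGraph.dist_eq_one_iff_adj.2 (graphJoin_adj_inl_inl.2 h)

theorem graphJoin_dist_inr_inr [Nonempty α] [DecidableEq β] [DecidableRel H.Adj] (a b : β) :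
    (graphJoin G H).dist (.inr a) (.inr b) = if a = b then 0 else if H.Adj a b then 1 else 2 := by
  split_ifs with h h'
  · simp [h]
  · exact SimpleGraph.dist_eq_one_iff_adj.2 (graphJoin_adj_inr_inr.2 h')
  · obtain ⟨w⟩ := ‹Nonempty α›
    exact SimpleGraph.dist_eq_two_of_adj_adj (by simpa using h)
      (fun k => h' (graphJoin_adj_inr_inr.1 k)) graphJoin_adj_inl_inr.symm
      (graphJoin_adj_inl_inr (a := w))

end Join

theorem Matrix.mem_spectrum_iff_exists_mulVec {V : Type*} [Fintype V] [DecidableEq V]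
    (M : Matrix V V ℝ) (μ : ℝ) :
    μ ∈ spectrum ℝ M ↔ ∃ v : V → ℝ, v ≠ 0 ∧ M *ᵥ v = μ • v := by
  rw [← Matrix.spectrum_toLin', ← Module.End.hasEigenvalue_iff_mem_spectrum]
  constructor
  · intro h
    obtain ⟨v, hv⟩ := h.exists_hasEigenvector
    exact ⟨v, hv.2, by simpa using hv.apply_eq_smul⟩
  · rintro ⟨v, h0, hv⟩
    exact Module.End.hasEigenvalue_of_hasEigenvector
      (Module.End.hasEigenvector_iff.2 ⟨Module.End.mem_eigenspace_iff.2 (by simpa using hv), h0⟩)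

/-- A Collatz–Wielandt type upper bound for the distance spectral radius. -/
theorem distSpecRad_le_of_mulVec_le {V : Type*} [Fintype V] [DecidableEq V]
    (G : SimpleGraph V) {x : V → ℝ} {μ : ℝ} (hμ : 0 ≤ μ) (hx : ∀ i, 0 < x i)
    (h : ∀ i, (distMatrix G *ᵥ x) i ≤ μ * x i) : distSpecRad G ≤ μ := by
  refine Real.sSup_le (fun lam hl => ?_) hμ
  obtain ⟨v, hv0, hv⟩ := (Matrix.mem_spectrum_iff_exists_mulVec _ _).1 hl
  obtain ⟨k, hk⟩ := Function.ne_iff.1 hv0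
  have hS : 0 < ∑ i, |v i| * x i :=
    Finset.sum_pos' (fun i _ => mul_nonneg (abs_nonneg _) (hx i).le)
      ⟨k, Finset.mem_univ _, mul_pos (abs_pos.2 hk) (hx k)⟩
  refine le_of_mul_le_mul_right ?_ hS
  calc lam * ∑ i, |v i| * x i
      = ∑ i, (lam * |v i|) * x i := by rw [Finset.mul_sum]; simp only [mul_assoc]
    _ ≤ ∑ i, (∑ j, (G.dist i j : ℝ) * |v j|) * x i := by
        refine Finset.sum_le_sum fun i _ => mul_le_mul_of_nonneg_right ?_ (hx i).le
        calc lam * |v i| ≤ |lam * v i| := by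
              rw [abs_mul]; exact mul_le_mul_of_nonneg_right (le_abs_self _) (abs_nonneg _)
          _ = |∑ j, (G.dist i j : ℝ) * v j| := by
              have := congrFun hv i
              simp only [Matrix.mulVec, dotProduct, distMatrix, Matrix.of_apply, Pi.smul_apply,
                smul_eq_mul] at this
              rw [this]
          _ ≤ ∑ j, (G.dist i j : ℝ) * |v j| := by
              refine (Finset.abs_sum_le_sum_abs _ _).trans_eq ?_
              simp [abs_mul]
    _ = ∑ j, |v j| * (distMatrix G *ᵥ x) j := by
        simp only [Matrix.mulVec, dotProduct, distMatrix, Matrix.of_apply, Finset.sum_mul,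
          Finset.mul_sum]
        rw [Finset.sum_comm]
        refine Finset.sum_congr rfl fun i _ => Finset.sum_congr rfl fun j _ => ?_
        rw [G.dist_comm]; ring
    _ ≤ ∑ j, |v j| * (μ * x j) :=
        Finset.sum_le_sum fun j _ => mul_le_mul_of_nonneg_left (h j) (abs_nonneg _)
    _ = μ * ∑ i, |v i| * x i := by
        rw [Finset.mul_sum]; exact Finset.sum_congr rfl fun _ _ => by ring

theorem le_distSpecRad_of_mulVec_eq {V : Type*} [Fintype V] [DecidableEq V]
    (G : SimpleGraph V) {x : V → ℝ} {μ : ℝ} (hx : x ≠ 0)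
    (h : distMatrix G *ᵥ x = μ • x) : μ ≤ distSpecRad G :=
  le_csSup (Matrix.finite_real_spectrum.bddAbove)
    ((Matrix.mem_spectrum_iff_exists_mulVec _ _).2 ⟨x, hx, h⟩)

theorem sum_ite_eq_zero_else {m : ℕ} (i : Fin m) (a c : ℝ) :
    ∑ j : Fin m, (if i = j then 0 else c) * a = (m - 1) * (c * a) := by
  have : ∀ j : Fin m, (if i = j then 0 else c) * a = c * a - if i = j then c * a else 0 := by
    intro j; split_ifs <;> ring
  simp only [this, Finset.sum_sub_distrib]
  simp
  ring

theorem distMatrix_starGraph_mulVec (m k : ℕ) (a b c : ℝ) :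
    distMatrix (graphJoin (⊤ : SimpleGraph (Fin 1))
      (graphDisjUnion (⊤ : SimpleGraph (Fin m)) (⊥ : SimpleGraph (Fin k)))) *ᵥ
        Sum.elim (fun _ => a) (Sum.elim (fun _ => b) (fun _ => c)) =
      Sum.elim (fun _ => m * b + k * c)
        (Sum.elim (fun _ => a + (m - 1) * b + 2 * k * c)
          (fun _ => a + 2 * m * b + 2 * (k - 1) * c)) := by
  classical
  have key : ∀ i j : Fin m, (if i = j then (0 : ℝ) else if i = j then 2 else 1)
      = if i = j then 0 else 1 := by intro i j; split_ifs <;> rfl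
  ext (i | i | i)
  · simp [Matrix.mulVec, dotProduct, distMatrix, graphJoin_top_dist_inl_inl,
      graphJoin_dist_inl_inr, Subsingleton.elim i 0]
  · simp [Matrix.mulVec, dotProduct, distMatrix, graphJoin_dist_inr_inl,
      graphJoin_dist_inr_inr, graphDisjUnion_adj_inl_inl, not_graphDisjUnion_adj_inl_inr, key,
      sum_ite_eq_zero_else, -ite_mul, -mul_ite]
    ring
  · simp [Matrix.mulVec, dotProduct, distMatrix, graphJoin_dist_inr_inl,
      graphJoin_dist_inr_inr, graphDisjUnion_adj_inr_inr, not_graphDisjUnion_adj_inr_inl,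
      sum_ite_eq_zero_else, -ite_mul, -mul_ite]
    ring

theorem distMatrix_sharpGraph_mulVec (s m : ℕ) [NeZero s] (a b : ℝ) :
    distMatrix (graphJoin (⊤ : SimpleGraph (Fin s)) (⊥ : SimpleGraph (Fin m))) *ᵥ
        Sum.elim (fun _ => a) (fun _ => b) =
      Sum.elim (fun _ => (s - 1) * a + m * b) (fun _ => s * a + 2 * (m - 1) * b) := by
  classical
  ext (i | i)
  · simp [Matrix.mulVec, dotProduct, distMatrix, graphJoin_top_dist_inl_inl,
      graphJoin_dist_inl_inr, sum_ite_eq_zero_else, -ite_mul, -mul_ite]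
  · simp [Matrix.mulVec, dotProduct, distMatrix, graphJoin_dist_inr_inl,
      graphJoin_dist_inr_inr, sum_ite_eq_zero_else, -ite_mul, -mul_ite]
    ring

theorem distSpecRad_starGraph_le (t : ℕ) (ht : 4 ≤ t) :
    distSpecRad (starGraph (3 * t) 4) ≤ 4 * t + 3 / 2 := by
  have hT : (4 : ℝ) ≤ t := by exact_mod_cast ht
  have hm : ((3 * t - 4 - 1 : ℕ) : ℝ) = 3 * t - 5 := by
    rw [Nat.sub_sub, Nat.cast_sub (by omega)]; push_cast; ring
  set μ : ℝ := 4 * t + 3 / 2 with hμ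
  -- the second column of the adjugate of `μ - Q`, with `Q` the quotient matrix
  refine distSpecRad_le_of_mulVec_le _ (x := Sum.elim (fun _ => (3 * t - 5) * (μ + 2))
    (Sum.elim (fun _ => μ * (μ - 6) - 4) (fun _ => (3 * t - 5) * (2 * μ + 1)))) (by positivity)
    ?_ ?_
  · rintro (i | i | i) <;> simp only [Sum.elim_inl, Sum.elim_inr, hμ]
    · exact mul_pos (by linarith) (by linarith)
    · nlinarith
    · exact mul_pos (by linarith) (by linarith)
  · intro i
    rw [starGraph, distMatrix_starGraph_mulVec, hm]
    obtain i | i | i := i <;> simp only [Sum.elim_inl, Sum.elim_inr, hμ] <;> push_cast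
    · apply le_of_eq; ring
    · obtain ⟨r, hr⟩ : ∃ r : ℝ, (t : ℝ) = 4 + r := ⟨t - 4, by ring⟩
      have hr0 : 0 ≤ r := by linarith
      rw [hr, ← sub_nonneg]
      ring_nf
      positivity
    · apply le_of_eq; ring

theorem lt_distSpecRad_sharpGraph (t : ℕ) (ht : 4 ≤ t) :
    4 * t + 3 / 2 < distSpecRad (sharpGraph (3 * t)) := by
  have hT : (4 : ℝ) ≤ t := by exact_mod_cast ht
  have hs : (3 * t - 3) / 3 = t - 1 := by omega
  have hm : (2 * (3 * t) + 3) / 3 = 2 * t + 1 := by omega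
  have hs' : ((t - 1 : ℕ) : ℝ) = t - 1 := by rw [Nat.cast_sub (by omega)]; simp
  have : NeZero (t - 1) := ⟨by omega⟩
  have hsq : Real.sqrt (17 * t ^ 2 + 8 * t) ^ 2 = 17 * t ^ 2 + 8 * t :=
    Real.sq_sqrt (by positivity)
  have hlt : 3 * (t : ℝ) + 5 < Real.sqrt (17 * t ^ 2 + 8 * t) :=
    Real.lt_sqrt_of_sq_lt (by nlinarith)
  set r := Real.sqrt (17 * t ^ 2 + 8 * t)
  refine lt_of_lt_of_le (b := (5 * t - 2 + r) / 2) (by linarith) ?_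
  rw [sharpGraph, hs, hm]
  refine le_distSpecRad_of_mulVec_eq _
    (x := Sum.elim (fun _ => 2 * t + 1) (fun _ => (3 * t + 2 + r) / 2)) ?_ ?_
  · intro h
    have := congrFun h (.inr 0)
    simp only [Sum.elim_inr, Pi.zero_apply] at this
    linarith
  · rw [distMatrix_sharpGraph_mulVec, hs']
    ext (i | i) <;> simp only [Sum.elim_inl, Sum.elim_inr, Pi.smul_apply, smul_eq_mul] <;>
      push_cast
    · ring
    · linear_combination -hsq / 4

/-- **Claim 4 (Statement 10).** Let `n ≥ 12` with `3 ∣ n`. Then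
`λ₁(D(K₁ ∨ (K_{n-5} ∪ 4K₁))) < λ₁(D(K_{(n-3)/3} ∨ ((2n+3)/3)K₁))`. -/
theorem distSpecRad_star_lt_sharp (n : ℕ) (hn : 12 ≤ n) (h3 : 3 ∣ n) :
    distSpecRad (starGraph n 4) < distSpecRad (sharpGraph n) := by
  obtain ⟨t, rfl⟩ := h3
  have ht : 4 ≤ t := by omega
  exact (distSpecRad_starGraph_le t ht).trans_lt (lt_distSpecRad_sharpGraph t ht)
end
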